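/- (Explicit form of the length-3 half-relation polynomial.) For every q : ℝ and all integers a₁, a₂, a₃, setting M := A^{a₁} * (B q)^{a₂} * A^{a₃} in SL(2,ℝ), one has q * (M 0 1) - (M 1 0) = q * ( (a₁*a₂*a₃) * q + (a₁ - a₂ + a₃) ), where the integer coefficients are coerced to ℝ. -/

import Mathlib

abbrev SL2R := Matrix.SpecialLinearGroup (Fin 2) ℝ

/-- The matrix `A = [[1,1],[0,1]]` in `SL(2,ℝ)`. -/
def A : SL2R := ⟨!![1,1;0,1], by norm_num [Matrix.det_fin_two_of]⟩

/-- The matrix `B q = [[1,0],[q,1]]` in `SL(2,ℝ)`. -/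
def B (q : ℝ) : SL2R := ⟨!![1,0;q,1], by norm_num [Matrix.det_fin_two_of]⟩

theorem coe_A_zpow (n : ℤ) :
    ((A ^ n : SL2R) : Matrix (Fin 2) (Fin 2) ℝ) = !![1, (n : ℝ); 0, 1] := by
  have hA : (A : Matrix (Fin 2) (Fin 2) ℝ) = !![1, 1; 0, 1] := rfl
  induction n with
  | zero => simp [Matrix.one_fin_two]
  | succ n ih =>
    rw [zpow_add_one, Matrix.SpecialLinearGroup.coe_mul, ih, hA]
    simp [add_comm]
  | pred n ih =>
    rw [zpow_sub_one, Matrix.SpecialLinearGroup.coe_mul, ih, Matrix.SpecialLinearGroup.coe_inv, hA]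
    simp [Matrix.adjugate_fin_two_of]
    ring

theorem coe_B_zpow (q : ℝ) (n : ℤ) :
    ((B q ^ n : SL2R) : Matrix (Fin 2) (Fin 2) ℝ) = !![1, 0; n * q, 1] := by
  have hB : (B q : Matrix (Fin 2) (Fin 2) ℝ) = !![1, 0; q, 1] := rfl
  induction n with
  | zero => simp [Matrix.one_fin_two]
  | succ n ih =>
    rw [zpow_add_one, Matrix.SpecialLinearGroup.coe_mul, ih, hB]
    simp [add_mul]
  | pred n ih =>
    rw [zpow_sub_one, Matrix.SpecialLinearGroup.coe_mul, ih, Matrix.SpecialLinearGroup.coe_inv, hB]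
    simp [Matrix.adjugate_fin_two_of]
    ring

/-- Explicit form of the length-3 half-relation polynomial. -/
theorem half_relation_poly_three (q : ℝ) (a₁ a₂ a₃ : ℤ) :
    q * ((A ^ a₁ * (B q) ^ a₂ * A ^ a₃) 0 1) - ((A ^ a₁ * (B q) ^ a₂ * A ^ a₃) 1 0)
    = q * ((a₁ * a₂ * a₃ : ℤ) * q + (a₁ - a₂ + a₃ : ℤ)) := by
  simp only [Matrix.SpecialLinearGroup.coe_mul, coe_A_zpow, coe_B_zpow, Matrix.mul_fin_two]
  simp
  ring
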